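/- Let H > 0, c > 0, α ∈ [0,1], and let f : ℝ^d → ℝ^d satisfy ‖f‖_{C^α} ≤ 1. Then there exists a constant N depending only on H, α, d (and c) such that for all t ∈ (0,1] and all x₁, x₂, x₃, x₄ ∈ ℝ^d: |𝒫^H_t f(x₁) − 𝒫^H_t f(x₂) − 𝒫^H_t f(x₃) + 𝒫^H_t f(x₄)| ≤ N ( t^{H(α−2)} |x₁−x₂| |x₁−x₃| + t^{H(α−1)} |x₁−x₂−x₃+x₄| ). -/

import Mathlib

open MeasureTheory Real
open scoped ENNReal NNReal

/-- The centred Gaussian density on `ℝ^d` with covariance matrix `v` times the identity. -/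
noncomputable def gaussDensity (d : ℕ) (v : ℝ) (x : Fin d → ℝ) : ℝ :=
  (2 * π * v) ^ (-(d : ℝ) / 2) * Real.exp (-(∑ j, x j ^ 2) / (2 * v))

/-- `𝒫^H_t f = 𝒫_{c t^{2H}} f`: convolution of `f` with the Gaussian density whose
covariance matrix is `c t^{2H}` times the identity. -/
noncomputable def heatSemigroup (d : ℕ) (c H t : ℝ) (f : (Fin d → ℝ) → (Fin d → ℝ))
    (x : Fin d → ℝ) : Fin d → ℝ :=
  ∫ y : Fin d → ℝ, gaussDensity d (c * t ^ (2 * H)) (fun j => x j - y j) • f y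

lemma gd_nonneg (d : ℕ) {v : ℝ} (hv : 0 < v) (x : Fin d → ℝ) : 0 ≤ gaussDensity d v x := by
  unfold gaussDensity; positivity

lemma gd_cont (d : ℕ) (v : ℝ) : Continuous (gaussDensity d v) := by
  unfold gaussDensity; fun_prop

lemma gd_prod (d : ℕ) (v : ℝ) (x : Fin d → ℝ) :
    Real.exp (-(∑ j, x j ^ 2) / (2 * v)) = ∏ j, Real.exp (-(1 / (2 * v)) * x j ^ 2) := by
  rw [← Real.exp_sum, ← Finset.mul_sum]; congr 1; ring

lemma gd_int (d : ℕ) {v : ℝ} (hv : 0 < v) : Integrable (gaussDensity d v) := by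
  unfold gaussDensity
  apply Integrable.const_mul
  simp_rw [gd_prod]
  exact Integrable.fintype_prod (f := fun _ (y : ℝ) => Real.exp (-(1 / (2 * v)) * y ^ 2))
    (fun _ => integrable_exp_neg_mul_sq (by positivity))

lemma gd_integral (d : ℕ) {v : ℝ} (hv : 0 < v) : ∫ x, gaussDensity d v x = 1 := by
  unfold gaussDensity
  rw [integral_const_mul]
  simp_rw [gd_prod]
  rw [integral_fintype_prod_volume_eq_pow (fun y : ℝ => Real.exp (-(1 / (2 * v)) * y ^ 2)),
    integral_gaussian]
  have h1 : π / (1 / (2 * v)) = 2 * π * v := by field_simp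
  have h2 : 0 < 2 * π * v := by positivity
  rw [h1, Real.sqrt_eq_rpow, ← Real.rpow_natCast, ← Real.rpow_mul h2.le, ← Real.rpow_add h2]
  simp; ring_nf; simp

lemma gd_sqrt (d : ℕ) {v : ℝ} (hv : 0 < v) (z h : Fin d → ℝ) :
    √(gaussDensity d v (z + h)) * √(gaussDensity d v z)
      = gaussDensity d v (z + (1 / 2 : ℝ) • h) * Real.exp (-(∑ j, h j ^ 2) / (8 * v)) := by
  rw [← Real.sqrt_mul (gd_nonneg d hv _)]
  rw [Real.sqrt_eq_iff_mul_self_eq (mul_nonneg (gd_nonneg d hv _) (gd_nonneg d hv _))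
    (mul_nonneg (gd_nonneg d hv _) (Real.exp_pos _).le)]
  unfold gaussDensity
  have key : ∀ a b c d e : ℝ, c + c + d + d = a + b →
     (e * Real.exp c * Real.exp d) * (e * Real.exp c * Real.exp d) = e * Real.exp a * (e * Real.exp b) := by
    intro a b c d e h
    have : Real.exp a * Real.exp b = Real.exp c * Real.exp c * Real.exp d * Real.exp d := by
      rw [← Real.exp_add, ← h]; simp only [Real.exp_add]
    linear_combination -e*e*this
  symm
  apply key
  have : ∑ j, (z + h) j ^ 2 = 2 * ∑ j, (z + (1 / 2 : ℝ) • h) j ^ 2 + (1 / 2) * ∑ j, h j ^ 2 - ∑ j, z j ^ 2 := by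
    rw [Finset.mul_sum, Finset.mul_sum, ← Finset.sum_add_distrib, ← Finset.sum_sub_distrib]
    refine Finset.sum_congr rfl fun j _ => ?_
    simp; ring
  rw [this]; field_simp; ring

lemma sum_sq_le (d : ℕ) (h : Fin d → ℝ) : ∑ j, h j ^ 2 ≤ ((d + 1) * ‖h‖) ^ 2 := by
  have : ∑ j, h j ^ 2 ≤ ∑ j : Fin d, ‖h‖ ^ 2 := by
    refine Finset.sum_le_sum fun j _ => ?_
    rw [← sq_abs]
    exact pow_le_pow_left₀ (abs_nonneg _) (norm_le_pi_norm h j) 2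
  simp at this
  have hd : (0 : ℝ) ≤ d := by positivity
  nlinarith [sq_nonneg ‖h‖, mul_nonneg hd (sq_nonneg ‖h‖), mul_nonneg (mul_nonneg hd hd) (sq_nonneg ‖h‖)]

lemma gd_tv (d : ℕ) {v : ℝ} (hv : 0 < v) (h : Fin d → ℝ) :
    ∫ z, |gaussDensity d v (z + h) - gaussDensity d v z| ≤ (d + 1) / √v * ‖h‖ := by
  rcases eq_or_ne h 0 with rfl | hh
  · simp
  have hn : 0 < ‖h‖ := norm_pos_iff.2 hh
  have hsv : 0 < √v := Real.sqrt_pos.2 hv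
  set K := (d + 1) / √v * ‖h‖ with hK
  have hKpos : 0 < K := by positivity
  set s := ∑ j, h j ^ 2 with hs
  have hsK : s / v ≤ K ^ 2 := by
    rw [div_le_iff₀ hv]
    have := sum_sq_le d h
    have e : K ^ 2 * v = ((d + 1) * ‖h‖) ^ 2 := by
      rw [hK]; nth_rw 2 [← Real.sq_sqrt hv.le]; field_simp
    rw [e]; exact this
  set E := Real.exp (-s / (8 * v)) with hE
  have hE1 : 1 - E ≤ K ^ 2 / 8 := by
    have := Real.add_one_le_exp (-s / (8 * v))
    have e : -s / (8 * v) = - (s / v) / 8 := by field_simp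
    rw [e] at this
    rw [hE, e]; linarith
  have i0 := gd_int d hv
  have i1 : Integrable (fun z => gaussDensity d v (z + h)) := i0.comp_add_right h
  have i2 : Integrable (fun z => gaussDensity d v (z + (1 / 2 : ℝ) • h)) := i0.comp_add_right _
  have pt : ∀ z, |gaussDensity d v (z + h) - gaussDensity d v z| ≤
      (2 / K) * (gaussDensity d v (z + h) + gaussDensity d v z
        - 2 * E * gaussDensity d v (z + (1 / 2 : ℝ) • h))
      + (K / 4) * (gaussDensity d v (z + h) + gaussDensity d v z) := by
    intro z
    have h1 := Real.sq_sqrt (gd_nonneg d hv (z + h))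
    have h2 := Real.sq_sqrt (gd_nonneg d hv z)
    have h3 := gd_sqrt d hv z h
    have ha := Real.sqrt_nonneg (gaussDensity d v (z + h))
    have hb := Real.sqrt_nonneg (gaussDensity d v z)
    rw [← hs, ← hE] at h3
    set a := √(gaussDensity d v (z + h))
    set b := √(gaussDensity d v z)
    have h4 : 2 * E * gaussDensity d v (z + (1 / 2 : ℝ) • h) = 2 * (a * b) := by rw [h3]; ring
    rw [h4, ← h1, ← h2]
    have h5 : |a ^ 2 - b ^ 2| = |a - b| * (a + b) := by
      rw [show a ^ 2 - b ^ 2 = (a - b) * (a + b) by ring, abs_mul, abs_of_nonneg (add_nonneg ha hb)]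
    rw [h5]
    have h6 : (a ^ 2 + b ^ 2 - 2 * (a * b)) = |a - b| ^ 2 := by rw [sq_abs]; ring
    rw [h6]
    have h7 : (a + b) ^ 2 ≤ 2 * (a ^ 2 + b ^ 2) := by nlinarith [sq_nonneg (a - b)]
    have h8 : |a - b| * (a + b) ≤ 2 / K * |a - b| ^ 2 + K / 8 * (a + b) ^ 2 := by
      have : 2 / K * |a - b| ^ 2 + K / 8 * (a + b) ^ 2 - |a - b| * (a + b)
        = (2 / K) * (|a - b| - K / 4 * (a + b)) ^ 2 := by field_simp; ring
      have : 0 ≤ (2 / K) * (|a - b| - K / 4 * (a + b)) ^ 2 := by positivity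
      linarith
    nlinarith
  have i3 : Integrable (fun z => gaussDensity d v (z + h) + gaussDensity d v z) := i1.add i0
  have j1 : Integrable (fun z => (2 / K) * (gaussDensity d v (z + h) + gaussDensity d v z
        - 2 * E * gaussDensity d v (z + (1 / 2 : ℝ) • h))) := (i3.sub (i2.const_mul _)).const_mul _
  have j2 : Integrable (fun z => (K / 4) * (gaussDensity d v (z + h) + gaussDensity d v z)) :=
    i3.const_mul _
  have hint : ∫ z, ((2 / K) * (gaussDensity d v (z + h) + gaussDensity d v z
        - 2 * E * gaussDensity d v (z + (1 / 2 : ℝ) • h))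
      + (K / 4) * (gaussDensity d v (z + h) + gaussDensity d v z))
      = (2 / K) * (1 + 1 - 2 * E) + (K / 4) * (1 + 1) := by
    rw [integral_add j1 j2,
      integral_const_mul, integral_const_mul, integral_sub i3 (i2.const_mul _),
      integral_const_mul]
    rw [integral_add i1 i0, integral_add_right_eq_self, integral_add_right_eq_self, gd_integral d hv]
    ring
  calc _ ≤ _ := integral_mono (i1.sub i0).abs (j1.add j2) pt
    _ = _ := hint
    _ ≤ K := by
      have : 2 / K * (1 + 1 - 2 * E) ≤ 2 / K * (2 * (K ^ 2 / 8)) :=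
        mul_le_mul_of_nonneg_left (by linarith) (by positivity)
      have e : 2 / K * (2 * (K ^ 2 / 8)) = K / 2 := by field_simp; norm_num
      linarith

/-- convolution with Gaussian of variance `v` -/
noncomputable def PP (d : ℕ) (v : ℝ) (f : (Fin d → ℝ) → (Fin d → ℝ)) (x : Fin d → ℝ) :
    Fin d → ℝ := ∫ y, gaussDensity d v (x - y) • f y

lemma PP_int (d : ℕ) {v M : ℝ} (hv : 0 < v) {f : (Fin d → ℝ) → (Fin d → ℝ)} (hf : Measurable f)
    (hM : ∀ x, ‖f x‖ ≤ M) (x : Fin d → ℝ) :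
    Integrable (fun y => gaussDensity d v (x - y) • f y) := by
  refine (((gd_int d hv).comp_sub_left x).mul_const M).mono' ?_ ?_
  · exact (((gd_cont d v).comp (continuous_const.sub continuous_id)).measurable.smul hf).aestronglyMeasurable
  · refine Filter.Eventually.of_forall fun y => ?_
    rw [norm_smul, Real.norm_of_nonneg (gd_nonneg d hv _)]
    exact mul_le_mul_of_nonneg_left (hM y) (gd_nonneg d hv _)

lemma PP_diff_bdd (d : ℕ) {v M : ℝ} (hv : 0 < v) {f : (Fin d → ℝ) → (Fin d → ℝ)} (hf : Measurable f)
    (hM : ∀ x, ‖f x‖ ≤ M) (x h : Fin d → ℝ) :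
    ‖PP d v f (x + h) - PP d v f x‖ ≤ M * ((d + 1) / √v * ‖h‖) := by
  have hM0 : 0 ≤ M := (norm_nonneg _).trans (hM 0)
  unfold PP
  rw [← integral_sub (PP_int d hv hf hM _) (PP_int d hv hf hM _)]
  have i0 := gd_int d hv
  have i1 : Integrable (fun z => |gaussDensity d v (z + h) - gaussDensity d v z|) :=
    ((i0.comp_add_right h).sub i0).abs
  have e : ∫ y, M * |gaussDensity d v (x - y + h) - gaussDensity d v (x - y)| =
      M * ∫ z, |gaussDensity d v (z + h) - gaussDensity d v z| := by
    rw [integral_const_mul]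
    congr 1
    exact integral_sub_left_eq_self (fun z => |gaussDensity d v (z + h) - gaussDensity d v z|) volume x
  refine (norm_integral_le_of_norm_le ((i1.comp_sub_left x).const_mul M)
    (Filter.Eventually.of_forall fun y => ?_)).trans
    (e.le.trans (mul_le_mul_of_nonneg_left (gd_tv d hv h) hM0))
  rw [← sub_smul, norm_smul, mul_comm M, Real.norm_eq_abs, sub_add_eq_add_sub]
  exact mul_le_mul_of_nonneg_left (hM y) (abs_nonneg _)

lemma PP_flip (d : ℕ) {v : ℝ} (f : (Fin d → ℝ) → (Fin d → ℝ)) (x : Fin d → ℝ) :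
    PP d v f x = ∫ z, gaussDensity d v z • f (x - z) := by
  unfold PP
  rw [← integral_sub_left_eq_self (fun y => gaussDensity d v (x - y) • f y) volume x]
  simp

lemma PP_int' (d : ℕ) {v M : ℝ} (hv : 0 < v) {f : (Fin d → ℝ) → (Fin d → ℝ)} (hf : Measurable f)
    (hM : ∀ x, ‖f x‖ ≤ M) (x : Fin d → ℝ) :
    Integrable (fun z => gaussDensity d v z • f (x - z)) := by
  simpa using (PP_int d hv hf hM x).comp_sub_left x

lemma PP_diff_lip (d : ℕ) {v M L : ℝ} (hv : 0 < v) {f : (Fin d → ℝ) → (Fin d → ℝ)} (hf : Measurable f)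
    (hM : ∀ x, ‖f x‖ ≤ M) (hL : ∀ x y, ‖f x - f y‖ ≤ L * ‖x - y‖) (x h : Fin d → ℝ) :
    ‖PP d v f (x + h) - PP d v f x‖ ≤ L * ‖h‖ := by
  rw [PP_flip, PP_flip, ← integral_sub (PP_int' d hv hf hM _) (PP_int' d hv hf hM _)]
  have e : ∫ z, gaussDensity d v z * (L * ‖h‖) = L * ‖h‖ := by
    rw [integral_mul_const, gd_integral d hv, one_mul]
  refine (norm_integral_le_of_norm_le ((gd_int d hv).mul_const (L * ‖h‖))
    (Filter.Eventually.of_forall fun y => ?_)).trans e.le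
  rw [← smul_sub, norm_smul, Real.norm_of_nonneg (gd_nonneg d hv _)]
  refine mul_le_mul_of_nonneg_left ?_ (gd_nonneg d hv _)
  simpa using hL (x + h - y) (x - y)

lemma PP_bdd (d : ℕ) {v M : ℝ} (hv : 0 < v) {f : (Fin d → ℝ) → (Fin d → ℝ)}
    (hM : ∀ x, ‖f x‖ ≤ M) (x : Fin d → ℝ) : ‖PP d v f x‖ ≤ M := by
  rw [PP_flip]
  have e : ∫ z, gaussDensity d v z * M = M := by
    rw [integral_mul_const, gd_integral d hv, one_mul]
  refine (norm_integral_le_of_norm_le ((gd_int d hv).mul_const M)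
    (Filter.Eventually.of_forall fun y => ?_)).trans e.le
  rw [norm_smul, Real.norm_of_nonneg (gd_nonneg d hv _)]
  exact mul_le_mul_of_nonneg_left (hM _) (gd_nonneg d hv _)

lemma PP_meas (d : ℕ) {v M : ℝ} (hv : 0 < v) {f : (Fin d → ℝ) → (Fin d → ℝ)} (hf : Measurable f)
    (hM : ∀ x, ‖f x‖ ≤ M) : Measurable (PP d v f) := by
  have hM0 : 0 ≤ M := (norm_nonneg _).trans (hM 0)
  have : LipschitzWith (Real.toNNReal (M * ((d + 1) / √v))) (PP d v f) := by
    refine LipschitzWith.of_dist_le_mul fun x y => ?_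
    rw [dist_eq_norm, dist_eq_norm, Real.coe_toNNReal _ (by positivity)]
    have := PP_diff_bdd d hv hf hM y (x - y)
    rw [add_sub_cancel] at this
    linarith
  exact this.continuous.measurable

lemma gd_semi_pt (d : ℕ) {v : ℝ} (hv : 0 < v) (x y : Fin d → ℝ) :
    gaussDensity d (v / 2) (x - y) * gaussDensity d (v / 2) y
      = gaussDensity d v x * gaussDensity d (v / 4) (y - (1 / 2 : ℝ) • x) := by
  unfold gaussDensity
  have h1 : 2 * π * (v / 2) = π * v := by ring
  have hp : 0 < π * v := by positivity
  have e1 : (2 * π * v) ^ (-(d : ℝ) / 2) * (2 * π * (v / 4)) ^ (-(d : ℝ) / 2)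
      = (2 * π * (v / 2)) ^ (-(d : ℝ) / 2) * (2 * π * (v / 2)) ^ (-(d : ℝ) / 2) := by
    rw [← Real.mul_rpow (by positivity) (by positivity), ← Real.mul_rpow (by positivity) (by positivity)]
    congr 1; ring
  have e2 : Real.exp (-(∑ j, (x - y) j ^ 2) / (2 * (v / 2))) * Real.exp (-(∑ j, y j ^ 2) / (2 * (v / 2)))
     = Real.exp (-(∑ j, x j ^ 2) / (2 * v)) * Real.exp (-(∑ j, (y - (1 / 2 : ℝ) • x) j ^ 2) / (2 * (v / 4))) := by
    rw [← Real.exp_add, ← Real.exp_add]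
    congr 1
    have : ∑ j, (x - y) j ^ 2 = (1 / 2) * ∑ j, x j ^ 2 + 2 * ∑ j, (y - (1 / 2 : ℝ) • x) j ^ 2 - ∑ j, y j ^ 2 := by
      rw [Finset.mul_sum, Finset.mul_sum, ← Finset.sum_add_distrib, ← Finset.sum_sub_distrib]
      refine Finset.sum_congr rfl fun j _ => ?_
      simp; ring
    rw [this]; field_simp; ring
  rw [mul_mul_mul_comm, e2, ← e1]; ring

lemma gd_semi (d : ℕ) {v : ℝ} (hv : 0 < v) (x : Fin d → ℝ) :
    ∫ w, gaussDensity d (v / 2) (x - w) * gaussDensity d (v / 2) w = gaussDensity d v x := by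
  simp_rw [gd_semi_pt d hv]
  rw [integral_const_mul, integral_sub_right_eq_self (fun y => gaussDensity d (v / 4) y),
    gd_integral d (by positivity), mul_one]

lemma PP_semi (d : ℕ) {v M : ℝ} (hv : 0 < v) {f : (Fin d → ℝ) → (Fin d → ℝ)} (hf : Measurable f)
    (hM : ∀ x, ‖f x‖ ≤ M) (x : Fin d → ℝ) :
    PP d v f x = PP d (v / 2) (PP d (v / 2) f) x := by
  have hv2 : 0 < v / 2 := by positivity
  have hM0 : 0 ≤ M := (norm_nonneg _).trans (hM 0)
  have L : PP d v f x = ∫ y, ∫ w, (gaussDensity d (v / 2) (x - w) * gaussDensity d (v / 2) (w - y)) • f y := by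
    unfold PP
    congr 1; ext1 y
    rw [integral_smul_const]
    congr 1
    rw [← gd_semi d hv, ← integral_sub_right_eq_self _ y]
    congr 1; ext1 w; congr 2; abel
  rw [L, integral_integral_swap]
  · unfold PP
    congr 1; ext1 w
    rw [← integral_smul]
    congr 1; ext1 y
    rw [mul_smul]
  · have i0 := gd_int d hv2
    have c0 := gd_cont d (v / 2)
    have i1 : Integrable (fun p : (Fin d → ℝ) × (Fin d → ℝ) =>
        gaussDensity d (v / 2) (x - p.1) * gaussDensity d (v / 2) (p.1 - p.2)) (volume.prod volume) := by
      rw [integrable_prod_iff (by apply Continuous.aestronglyMeasurable; fun_prop)]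
      constructor
      · exact Filter.Eventually.of_forall fun w => (i0.comp_sub_left w).const_mul (gaussDensity d (v / 2) (x - w))
      · have : ∀ w, ∫ y, ‖gaussDensity d (v / 2) (x - w) * gaussDensity d (v / 2) (w - y)‖
            = gaussDensity d (v / 2) (x - w) := by
          intro w
          simp_rw [norm_mul, Real.norm_of_nonneg (gd_nonneg d hv2 _)]
          rw [integral_const_mul, integral_sub_left_eq_self (fun y => gaussDensity d (v / 2) y),
            gd_integral d hv2, mul_one]
        simp_rw [this]
        exact i0.comp_sub_left x
    have i2 := i1.swap
    refine (i2.mul_const M).mono' ?_ ?_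
    · apply Measurable.aestronglyMeasurable
      simp only [Function.uncurry_def]
      have m1 : Measurable (fun p : (Fin d → ℝ) × (Fin d → ℝ) =>
        gaussDensity d (v / 2) (x - p.2) * gaussDensity d (v / 2) (p.2 - p.1)) :=
        Continuous.measurable (by fun_prop)
      exact m1.smul (hf.comp measurable_fst)
    · refine Filter.Eventually.of_forall fun p => ?_
      simp only [Function.uncurry_def, Function.comp, Prod.swap]
      have hn := mul_nonneg (gd_nonneg d hv2 (x - p.2)) (gd_nonneg d hv2 (p.2 - p.1))
      rw [norm_smul, Real.norm_of_nonneg hn]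
      exact mul_le_mul_of_nonneg_left (hM _) hn

lemma PP_sub (d : ℕ) {v M M' : ℝ} (hv : 0 < v) {f g : (Fin d → ℝ) → (Fin d → ℝ)} (hf : Measurable f)
    (hM : ∀ x, ‖f x‖ ≤ M) (hg : Measurable g) (hM' : ∀ x, ‖g x‖ ≤ M') (x : Fin d → ℝ) :
    PP d v (fun y => f y - g y) x = PP d v f x - PP d v g x := by
  unfold PP
  rw [← integral_sub (PP_int d hv hf hM _) (PP_int d hv hg hM' _)]
  simp_rw [smul_sub]

lemma PP_trans (d : ℕ) {v : ℝ} (f : (Fin d → ℝ) → (Fin d → ℝ)) (x k : Fin d → ℝ) :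
    PP d v (fun y => f (y + k)) x = PP d v f (x + k) := by
  rw [PP_flip, PP_flip]
  congr 1; ext1 z; congr 2; abel

lemma approx_ex (d : ℕ) {α ρ : ℝ} (hα0 : 0 ≤ α) (hα1 : α ≤ 1) (hρ : 0 < ρ)
    (f : (Fin d → ℝ) → (Fin d → ℝ))
    (hh : ∀ x y, x ≠ y → ‖f x - f y‖ ≤ ‖x - y‖ ^ α) :
    ∃ g : (Fin d → ℝ) → (Fin d → ℝ), Measurable g ∧ (∀ x, ‖f x - g x‖ ≤ ρ ^ α) ∧
      ∀ x y, ‖g x - g y‖ ≤ ρ ^ (α - 1) * ‖x - y‖ := by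
  set L := ρ ^ (α - 1) with hL
  have hL0 : 0 < L := Real.rpow_pos_of_pos hρ _
  have low : ∀ x y i, f x i - ρ ^ α ≤ f y i + L * ‖x - y‖ := by
    intro x y i
    rcases eq_or_ne x y with rfl | hxy
    · simp; positivity
    have h1 : f x i - f y i ≤ ‖x - y‖ ^ α :=
      (le_abs_self _).trans ((norm_le_pi_norm (f x - f y) i).trans (hh x y hxy))
    have hr : 0 < ‖x - y‖ := norm_pos_iff.2 (sub_ne_zero.2 hxy)
    rcases le_total ‖x - y‖ ρ with hle | hle
    · have := Real.rpow_le_rpow hr.le hle hα0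
      have : 0 ≤ L * ‖x - y‖ := by positivity
      linarith
    · have e : ‖x - y‖ ^ α = ‖x - y‖ ^ (α - 1) * ‖x - y‖ := by
        rw [Real.rpow_sub_one hr.ne']; field_simp
      have h2 : ‖x - y‖ ^ (α - 1) ≤ L := Real.rpow_le_rpow_of_nonpos hρ hle (by linarith)
      have h3 := mul_le_mul_of_nonneg_right h2 hr.le
      have : 0 ≤ ρ ^ α := by positivity
      linarith
  have bb : ∀ x i, BddBelow (Set.range fun y => f y i + L * ‖x - y‖) := by
    intro x i
    refine ⟨f x i - ρ ^ α, ?_⟩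
    rintro _ ⟨y, rfl⟩
    exact low x y i
  let g : (Fin d → ℝ) → (Fin d → ℝ) := fun x i => ⨅ y, (f y i + L * ‖x - y‖)
  have lip1 : ∀ x y i, g x i ≤ g y i + L * ‖x - y‖ := by
    intro x y i
    rw [← sub_le_iff_le_add]
    refine le_ciInf fun z => ?_
    rw [sub_le_iff_le_add]
    refine (ciInf_le (bb x i) z).trans ?_
    have : ‖x - z‖ ≤ ‖x - y‖ + ‖y - z‖ := norm_sub_le_norm_sub_add_norm_sub x y z
    nlinarith
  have lip : ∀ x y, ‖g x - g y‖ ≤ L * ‖x - y‖ := by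
    intro x y
    refine (pi_norm_le_iff_of_nonneg (by positivity)).2 fun i => ?_
    rw [Real.norm_eq_abs, abs_le, Pi.sub_apply]
    have h1 := lip1 x y i
    have h2 := lip1 y x i
    rw [norm_sub_rev y x] at h2
    constructor <;> linarith
  refine ⟨g, ?_, ?_, lip⟩
  · have : LipschitzWith (Real.toNNReal L) g := by
      refine LipschitzWith.of_dist_le_mul fun x y => ?_
      rw [dist_eq_norm, dist_eq_norm, Real.coe_toNNReal _ hL0.le]
      exact lip x y
    exact this.continuous.measurable
  · intro x
    refine (pi_norm_le_iff_of_nonneg (by positivity)).2 fun i => ?_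
    rw [Real.norm_eq_abs, abs_le, Pi.sub_apply]
    have h1 : g x i ≤ f x i := by simpa using ciInf_le (bb x i) x
    have h2 : f x i - ρ ^ α ≤ g x i := le_ciInf fun y => low x y i
    have : 0 ≤ ρ ^ α := by positivity
    constructor <;> linarith

lemma first_order (d : ℕ) {α ρ v : ℝ} (hα0 : 0 ≤ α) (hα1 : α ≤ 1) (hρ : 0 < ρ) (hv : 0 < v)
    {f : (Fin d → ℝ) → (Fin d → ℝ)} (hf : Measurable f) (hM : ∀ x, ‖f x‖ ≤ 1)
    (hh : ∀ x y, x ≠ y → ‖f x - f y‖ ≤ ‖x - y‖ ^ α) (x h : Fin d → ℝ) :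
    ‖PP d v f (x + h) - PP d v f x‖ ≤ (ρ ^ α * ((d + 1) / √v) + ρ ^ (α - 1)) * ‖h‖ := by
  obtain ⟨g, hg, hfg, hlip⟩ := approx_ex d hα0 hα1 hρ f hh
  have hgM : ∀ x, ‖g x‖ ≤ 1 + ρ ^ α := by
    intro x
    have e : g x = f x - (f x - g x) := by abel
    rw [e]
    exact (norm_sub_le _ _).trans (add_le_add (hM x) (hfg x))
  have h1 := PP_diff_bdd d hv (hf.sub hg) hfg x h
  have h2 := PP_diff_lip d hv hg hgM hlip x h
  have e : ∀ z, PP d v (f - g) z = PP d v f z - PP d v g z := PP_sub d hv hf hM hg hgM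
  rw [e, e] at h1
  have e2 : PP d v f (x + h) - PP d v f x
    = (PP d v f (x + h) - PP d v g (x + h) - (PP d v f x - PP d v g x))
      + (PP d v g (x + h) - PP d v g x) := by abel
  rw [e2]
  refine (norm_add_le _ _).trans ((add_le_add h1 h2).trans (le_of_eq ?_))
  ring

lemma second_order (d : ℕ) {α ρ v : ℝ} (hα0 : 0 ≤ α) (hα1 : α ≤ 1) (hρ : 0 < ρ) (hv : 0 < v)
    {f : (Fin d → ℝ) → (Fin d → ℝ)} (hf : Measurable f) (hM : ∀ x, ‖f x‖ ≤ 1)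
    (hh : ∀ x y, x ≠ y → ‖f x - f y‖ ≤ ‖x - y‖ ^ α) (x h k : Fin d → ℝ) :
    ‖(PP d v f (x + h + k) - PP d v f (x + h)) - (PP d v f (x + k) - PP d v f x)‖ ≤
      ((ρ ^ α * ((d + 1) / √(v / 2)) + ρ ^ (α - 1)) * ‖k‖) * ((d + 1) / √(v / 2) * ‖h‖) := by
  have hv2 : 0 < v / 2 := by positivity
  have m := PP_meas d hv2 hf hM
  have b := PP_bdd d hv2 hM
  have mk : Measurable (fun y => PP d (v / 2) f (y + k)) := m.comp (measurable_id.add_const k)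
  have := PP_diff_bdd d hv2 (mk.sub m) (fun y => first_order d hα0 hα1 hρ hv2 hf hM hh y k) x h
  have e : ∀ z, PP d (v / 2) ((fun y => PP d (v / 2) f (y + k)) - PP d (v / 2) f) z
      = PP d v f (z + k) - PP d v f z := by
    intro z
    rw [PP_semi d hv hf hM, PP_semi d hv hf hM, ← PP_trans]
    exact PP_sub d hv2 mk (fun y => b _) m b z
  rwa [e, e] at this

/-- Let `H > 0`, `c > 0`, `α ∈ [0,1]`.  There is a constant `N`,
depending only on `H, α, d` (and `c`), such that for every `f : ℝ^d → ℝ^d` with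
`‖f‖_{C^α} ≤ 1`, all `t ∈ (0,1]` and all `x₁, x₂, x₃, x₄`:
`|𝒫^H_t f(x₁) − 𝒫^H_t f(x₂) − 𝒫^H_t f(x₃) + 𝒫^H_t f(x₄)|
  ≤ N (t^{H(α−2)} |x₁−x₂| |x₁−x₃| + t^{H(α−1)} |x₁−x₂−x₃+x₄|)`. -/
theorem stmt_11 (d : ℕ) (H c α : ℝ) (hH : 0 < H) (hc : 0 < c)
    (hα0 : 0 ≤ α) (hα1 : α ≤ 1) :
    ∃ N : ℝ, 0 ≤ N ∧
      ∀ f : (Fin d → ℝ) → (Fin d → ℝ), Measurable f →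
        (∀ x, ‖f x‖ ≤ 1) →
        (∀ x y, x ≠ y → ‖f x - f y‖ ≤ ‖x - y‖ ^ α) →
        ∀ t : ℝ, 0 < t → t ≤ 1 →
          ∀ x₁ x₂ x₃ x₄ : Fin d → ℝ,
            ‖heatSemigroup d c H t f x₁ - heatSemigroup d c H t f x₂
              - heatSemigroup d c H t f x₃ + heatSemigroup d c H t f x₄‖
              ≤ N * (t ^ (H * (α - 2)) * ‖x₁ - x₂‖ * ‖x₁ - x₃‖
                  + t ^ (H * (α - 1)) * ‖x₁ - x₂ - x₃ + x₄‖) := by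
  set B : ℝ := (d + 1) / √(c / 2) with hB
  set B' : ℝ := (d + 1) / √c with hB'
  have hsc : 0 < √c := Real.sqrt_pos.2 hc
  have hsc2 : 0 < √(c / 2) := Real.sqrt_pos.2 (by positivity)
  have hB0 : 0 ≤ B := by positivity
  have hB0' : 0 ≤ B' := by positivity
  refine ⟨(B + 1) * B + (B' + 1), by positivity, ?_⟩
  intro f hf hM hh t ht _ x₁ x₂ x₃ x₄
  set ρ := t ^ H with hρd
  have hρ : 0 < ρ := Real.rpow_pos_of_pos ht _
  set v := c * t ^ (2 * H) with hvd
  have hvρ : v = c * ρ ^ 2 := by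
    rw [hvd, hρd, ← Real.rpow_natCast, ← Real.rpow_mul ht.le]; congr 2; push_cast; ring
  have hv : 0 < v := by rw [hvρ]; positivity
  have hs1 : √v = √c * ρ := by rw [hvρ, Real.sqrt_mul hc.le, Real.sqrt_sq hρ.le]
  have hs2 : √(v / 2) = √(c / 2) * ρ := by
    rw [hvρ, show c * ρ ^ 2 / 2 = c / 2 * ρ ^ 2 by ring, Real.sqrt_mul (by positivity), Real.sqrt_sq hρ.le]
  have er1 : t ^ (H * (α - 1)) = ρ ^ (α - 1) := by rw [hρd, ← Real.rpow_mul ht.le]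
  have er2 : t ^ (H * (α - 2)) = ρ ^ (α - 1) / ρ := by
    rw [← Real.rpow_sub_one hρ.ne', hρd, ← Real.rpow_mul ht.le]; congr 1; ring
  have er0 : ρ ^ α = ρ ^ (α - 1) * ρ := by rw [Real.rpow_sub_one hρ.ne']; field_simp
  have hP : ∀ x, heatSemigroup d c H t f x = PP d v f x := fun x => rfl
  simp only [hP]
  rw [er1, er2]
  have s := second_order d hα0 hα1 hρ hv hf hM hh x₁ (x₂ - x₁) (x₃ - x₁)
  have p := first_order d hα0 hα1 hρ hv hf hM hh (x₁ + (x₂ - x₁) + (x₃ - x₁)) (x₁ - x₂ - x₃ + x₄)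
  rw [show x₁ + (x₂ - x₁) + (x₃ - x₁) + (x₁ - x₂ - x₃ + x₄) = x₄ by abel] at p
  rw [add_sub_cancel, add_sub_cancel] at s
  rw [add_sub_cancel] at p
  rw [hs1, er0] at p
  rw [hs2, er0, norm_sub_rev x₃, norm_sub_rev x₂] at s
  set q := ρ ^ (α - 1)
  have hq : 0 < q := Real.rpow_pos_of_pos hρ _
  have p' : ‖PP d v f x₄ - PP d v f (x₂ + (x₃ - x₁))‖ ≤ (B' + 1) * (q * ‖x₁ - x₂ - x₃ + x₄‖) := by
    refine p.trans (le_of_eq ?_)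
    rw [hB']; field_simp
  have s' : ‖PP d v f (x₂ + (x₃ - x₁)) - PP d v f x₂ - (PP d v f x₃ - PP d v f x₁)‖
      ≤ ((B + 1) * B) * (q / ρ * ‖x₁ - x₂‖ * ‖x₁ - x₃‖) := by
    refine s.trans (le_of_eq ?_)
    rw [hB]; field_simp
  have e : PP d v f x₁ - PP d v f x₂ - PP d v f x₃ + PP d v f x₄ =
    (PP d v f (x₂ + (x₃ - x₁)) - PP d v f x₂ - (PP d v f x₃ - PP d v f x₁))
     + (PP d v f x₄ - PP d v f (x₂ + (x₃ - x₁))) := by abel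
  rw [e]
  refine (norm_add_le _ _).trans ((add_le_add s' p').trans ?_)
  have a1 : 0 ≤ q / ρ * ‖x₁ - x₂‖ * ‖x₁ - x₃‖ := by positivity
  have a2 : 0 ≤ q * ‖x₁ - x₂ - x₃ + x₄‖ := by positivity
  have a3 : 0 ≤ (B + 1) * B := by positivity
  nlinarith [mul_nonneg a3 a2, mul_nonneg (add_nonneg hB0' zero_le_one) a1]
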